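/- Let Σ be a set of identities and V = Mod(Σ) the variety it axiomatizes. If every member of V is abelian and some member of V is not affine (i.e., some member of V has no Maltsev polynomial operation), then V contains a strongly abelian algebra with more than one element. -/

import Mathlib

namespace UA

/-- An algebraic language: a type of operation symbols with arities. -/
structure Lang where
  F : Type
  arity : F → ℕ

variable {L : Lang}

/-- An interpretation of the language `L` on the carrier `A` (an algebra structure). -/
def Interp (L : Lang) (A : Type) : Type :=
  (f : L.F) → ((Fin (L.arity f)) → A) → A

/-- Terms of the language `L` over a type `X` of variables. -/
inductive Term (L : Lang) (X : Type) : Type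
  | var : X → Term L X
  | app : (f : L.F) → ((Fin (L.arity f)) → Term L X) → Term L X

/-- Realization of a term under an assignment of the variables. -/
def Term.realize {A X : Type} (I : Interp L A) (v : X → A) : Term L X → A
  | .var x => v x
  | .app f ts => I f (fun i => (ts i).realize I v)

/-- Relabelling (substitution of variables) of terms. -/
def Term.relabel {X Y : Type} (g : X → Y) : Term L X → Term L Y
  | .var x => .var (g x)
  | .app f ts => .app f (fun i => (ts i).relabel g)

/-- `p` is a polynomial operation of the algebra `(A, I)` with argument-index type `X`:
it is the realization of a term in variables `X ⊕ Fin m` where the `Fin m` variables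
are evaluated at fixed constants. -/
def IsPolyOp {A X : Type} (I : Interp L A) (p : (X → A) → A) : Prop :=
  ∃ (m : ℕ) (t : Term L (X ⊕ Fin m)) (c : Fin m → A),
    ∀ x : X → A, p x = t.realize I (Sum.elim x c)

/-- A unary polynomial operation. -/
def IsUnaryPolyOp {A : Type} (I : Interp L A) (g : A → A) : Prop :=
  IsPolyOp I (fun x : Fin 1 → A => g (x 0))

/-- `(p, q, r, s)` is a `1,1`-matrix of the algebra `(A, I)`. -/
def Is11Matrix {A : Type} (I : Interp L A) (p q r s : A) : Prop :=
  ∃ (k l : ℕ) (t : ((Fin k ⊕ Fin l) → A) → A), IsPolyOp I t ∧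
    ∃ (a b : Fin k → A) (u v : Fin l → A),
      p = t (Sum.elim a u) ∧ q = t (Sum.elim a v) ∧
      r = t (Sum.elim b u) ∧ s = t (Sum.elim b v)

/-- The algebra is abelian: in every `1,1`-matrix, `p = q` implies `r = s`. -/
def IsAbelian {A : Type} (I : Interp L A) : Prop :=
  ∀ p q r s : A, Is11Matrix I p q r s → p = q → r = s

/-- The algebra is strongly rectangular: in every `1,1`-matrix, `q = r` implies `r = s`. -/
def IsStronglyRectangular {A : Type} (I : Interp L A) : Prop :=
  ∀ p q r s : A, Is11Matrix I p q r s → q = r → r = s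

/-- Strongly abelian = abelian + strongly rectangular. -/
def IsStronglyAbelian {A : Type} (I : Interp L A) : Prop :=
  IsAbelian I ∧ IsStronglyRectangular I

/-- The algebra has a Maltsev polynomial operation. -/
def HasMaltsevPoly {A : Type} (I : Interp L A) : Prop :=
  ∃ mOp : (Fin 3 → A) → A, IsPolyOp I mOp ∧
    ∀ x y : A, mOp ![x, y, y] = x ∧ mOp ![y, y, x] = x

/-- Affine = abelian + has a Maltsev polynomial operation. -/
def IsAffine {A : Type} (I : Interp L A) : Prop :=
  IsAbelian I ∧ HasMaltsevPoly I

/-- The algebra satisfies the identity `e.1 ≈ e.2`. -/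
def Satisfies {A : Type} (I : Interp L A) (e : Term L ℕ × Term L ℕ) : Prop :=
  ∀ v : ℕ → A, e.1.realize I v = e.2.realize I v

/-- Membership in the variety `Mod(E)` axiomatized by the set `E` of identities. -/
def InVariety {A : Type} (E : Set (Term L ℕ × Term L ℕ)) (I : Interp L A) : Prop :=
  ∀ e ∈ E, Satisfies I e

/-- `θ` is a congruence on the algebra `(A, I)`. -/
def IsCong {A : Type} (I : Interp L A) (θ : A → A → Prop) : Prop :=
  Equivalence θ ∧
    ∀ (f : L.F) (a b : Fin (L.arity f) → A),
      (∀ i, θ (a i) (b i)) → θ (I f a) (I f b)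

/-- `(p, q, r, s)` is a `θ`-matrix of the algebra `(A, I)`. -/
def IsThetaMatrix {A : Type} (I : Interp L A) (θ : A → A → Prop) (p q r s : A) : Prop :=
  ∃ (k l : ℕ) (t : ((Fin k ⊕ Fin l) → A) → A), IsPolyOp I t ∧
    ∃ (a b : Fin k → A) (u v : Fin l → A),
      (∀ i, θ (a i) (b i)) ∧ (∀ j, θ (u j) (v j)) ∧
      p = t (Sum.elim a u) ∧ q = t (Sum.elim a v) ∧
      r = t (Sum.elim b u) ∧ s = t (Sum.elim b v)

/-- `θ` is a strongly abelian congruence. -/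
def IsStronglyAbelianCong {A : Type} (I : Interp L A) (θ : A → A → Prop) : Prop :=
  ∀ p q r s : A, IsThetaMatrix I θ p q r s → (p = q → r = s) ∧ (q = r → r = s)

/-- `S` is a subuniverse of the algebra `(A, I)`. -/
def IsSubuniverse {A : Type} (I : Interp L A) (S : Set A) : Prop :=
  ∀ (f : L.F) (a : Fin (L.arity f) → A), (∀ i, a i ∈ S) → I f a ∈ S

/-- The substructure (restricted algebra structure) on a subuniverse. -/
def subInterp {A : Type} (I : Interp L A) (S : Set A) (hS : IsSubuniverse I S) :
    Interp L S :=
  fun f a => ⟨I f (fun i => (a i : A)), hS f _ (fun i => (a i).2)⟩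

/-- The componentwise algebra structure on a product. -/
def prodInterp {ι : Type} {A : ι → Type} (I : ∀ i, Interp L (A i)) :
    Interp L (∀ i, A i) :=
  fun f a i => I i f (fun j => a j i)

/-- The componentwise algebra structure on `A × A`. -/
def pairInterp {A : Type} (I : Interp L A) : Interp L (A × A) :=
  fun f a => (I f (fun i => (a i).1), I f (fun i => (a i).2))

/-- `h` is a homomorphism of `L`-algebras. -/
def IsHom {A B : Type} (I : Interp L A) (J : Interp L B) (h : A → B) : Prop :=
  ∀ (f : L.F) (a : Fin (L.arity f) → A), h (I f a) = J f (fun i => h (a i))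

/-- The induced algebra structure on the quotient by a congruence `ρ`
(well-defined, i.e. independent of the chosen representatives, when `ρ` is a congruence). -/
noncomputable def quotInterp {A : Type} (I : Interp L A) (ρ : A → A → Prop) :
    Interp L (Quot ρ) :=
  fun f a => Quot.mk ρ (I f (fun i => (a i).out))

/-- The subuniverse generated by a subset `G`: the intersection of all
subuniverses containing `G`. -/
def GenSub {A : Type} (I : Interp L A) (G : Set A) : Set A :=
  {x | ∀ S : Set A, IsSubuniverse I S → G ⊆ S → x ∈ S}

theorem genSub_isSubuniverse {A : Type} (I : Interp L A) (G : Set A) :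
    IsSubuniverse I (GenSub I G) :=
  fun f a ha S hS hG => hS f a (fun i => ha i S hS hG)

/-- The smallest congruence containing the pair `(x, y)`: the intersection of all
congruences containing it. -/
def genCong {A : Type} (I : Interp L A) (x y : A) : A → A → Prop :=
  fun w z => ∀ ρ : A → A → Prop, IsCong I ρ → ρ x y → ρ w z

/-- The carrier of `A(θ)`, the graph of `θ` inside `A × A`. -/
abbrev ThetaSub {A : Type} (θ : A → A → Prop) : Type := {z : A × A // θ z.1 z.2}

/-- The substructure `A(θ) ≤ A × A` supported by the graph of `θ`. -/
def thetaSubInterp {A : Type} (I : Interp L A) (θ : A → A → Prop) (hθ : IsCong I θ) :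
    Interp L (ThetaSub θ) :=
  fun f a => ⟨(I f (fun i => (a i).1.1), I f (fun i => (a i).1.2)),
    hθ.2 f _ _ (fun i => (a i).2)⟩

/-- The diagonal element `(c, c)` of `A(θ)`. -/
def diagEl {A : Type} {θ : A → A → Prop} (hrefl : ∀ a : A, θ a a) (c : A) :
    ThetaSub θ := ⟨(c, c), hrefl c⟩

/-- `Δ`: the smallest congruence of `A(θ)` containing `D × D`, where `D` is the
diagonal -- the intersection of all congruences of `A(θ)` containing `D × D`. -/
def DeltaRel {A : Type} (I : Interp L A) (θ : A → A → Prop) (hθ : IsCong I θ) :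
    ThetaSub θ → ThetaSub θ → Prop :=
  fun x y => ∀ ρ : ThetaSub θ → ThetaSub θ → Prop,
    IsCong (thetaSubInterp I θ hθ) ρ →
    (∀ c d : A, ρ (diagEl hθ.1.refl c) (diagEl hθ.1.refl d)) → ρ x y

/-- The quotient algebra `S = A(θ)/Δ`. -/
noncomputable def SInterp {A : Type} (I : Interp L A) (θ : A → A → Prop)
    (hθ : IsCong I θ) : Interp L (Quot (DeltaRel I θ hθ)) :=
  quotInterp (thetaSubInterp I θ hθ) (DeltaRel I θ hθ)

/-- The element `0` of `S = A(θ)/Δ`: the `Δ`-class of a diagonal element. -/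
def zeroS {A : Type} (I : Interp L A) (θ : A → A → Prop) (hθ : IsCong I θ) (d : A) :
    Quot (DeltaRel I θ hθ) :=
  Quot.mk _ (diagEl hθ.1.refl d)

/-- The diagonal of `B × B`. -/
def diagSet (B : Type) : Set (B × B) := {z | z.1 = z.2}

/-- The set of pairs `(u j, v j)`. -/
def pairsSet {B : Type} {l : ℕ} (u v : Fin l → B) : Set (B × B) :=
  {z | ∃ j, z = (u j, v j)}

/-- The carrier of the subalgebra `C ≤ B × B` generated by the diagonal and the
pairs `(u j, v j)`. -/
def CsetOf {L : Lang} {B : Type} (I : Interp L B) {l : ℕ} (u v : Fin l → B) :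
    Set (B × B) :=
  GenSub (pairInterp I) (diagSet B ∪ pairsSet u v)

/-- The subalgebra `C ≤ B × B` generated by the diagonal and the pairs `(u j, v j)`. -/
def CInterpOf {L : Lang} {B : Type} (I : Interp L B) {l : ℕ} (u v : Fin l → B) :
    Interp L (CsetOf I u v) :=
  subInterp (pairInterp I) _ (genSub_isSubuniverse _ _)


section Terms

theorem Term.realize_relabel {A X Y : Type} (I : Interp L A) (g : X → Y) (v : Y → A)
    (t : Term L X) : (t.relabel g).realize I v = t.realize I (v ∘ g) := by
  induction t with
  | var x => rfl
  | app f ts ih => simp only [Term.relabel, Term.realize, ih]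

theorem IsHom.map_realize {A B X : Type} {I : Interp L A} {J : Interp L B} {h : A → B}
    (hh : IsHom I J h) (t : Term L X) (v : X → A) :
    h (t.realize I v) = t.realize J (h ∘ v) := by
  induction t with
  | var x => rfl
  | app f ts ih => simp only [Term.realize, hh f, ih]

/-- The algebra of terms; realizing a term in it is substitution. -/
def termInterp (L : Lang) (X : Type) : Interp L (Term L X) := fun f ts => .app f ts

theorem isHom_realize {A X : Type} (I : Interp L A) (v : X → A) :
    IsHom (termInterp L X) I (fun t => t.realize I v) := fun _ _ => rfl

theorem Term.realize_subst {A X Y : Type} (I : Interp L A) (v : X → A) (σ : Y → Term L X)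
    (t : Term L Y) :
    (t.realize (termInterp L X) σ).realize I v = t.realize I (fun y => (σ y).realize I v) :=
  (isHom_realize I v).map_realize t σ

theorem Term.exists_fin_relabel {X : Type} (t : Term L X) :
    ∃ (n : ℕ) (g : Fin n → X) (t' : Term L (Fin n)), t = t'.relabel g := by
  induction t with
  | var x => exact ⟨1, fun _ => x, .var 0, rfl⟩
  | app f ts ih =>
    choose n g t' h using ih
    refine ⟨_, fun i => g (finSigmaFinEquiv.symm i).1 (finSigmaFinEquiv.symm i).2,
      .app f (fun i => (t' i).relabel fun j => finSigmaFinEquiv ⟨i, j⟩), ?_⟩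
    have relabel_relabel : ∀ {X Y Z : Type} (g : X → Y) (h : Y → Z) (t : Term L X),
        (t.relabel g).relabel h = t.relabel (h ∘ g) := by
      intro X Y Z g h t
      induction t with
      | var x => rfl
      | app f ts ih => simp only [Term.relabel, ih]
    simp only [Term.relabel, relabel_relabel]
    congr 1
    funext i
    conv_lhs => rw [h i]
    congr 1
    funext j
    change g i j = (fun p : (i : Fin (L.arity f)) × Fin (n i) => g p.1 p.2) _
    rw [Equiv.symm_apply_apply]

/-- A relation is compatible with all operations as soon as it is a preorder compatible with
every change of a single argument. -/
theorem compatible_of_update {A : Type} (I : Interp L A) {r : A → A → Prop}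
    (hrefl : ∀ x, r x x) (htrans : ∀ x y z, r x y → r y z → r x z)
    (hupd : ∀ (f : L.F) (a : Fin (L.arity f) → A) (i : Fin (L.arity f)) (x y : A), r x y →
      r (I f (Function.update a i x)) (I f (Function.update a i y)))
    (f : L.F) (a b : Fin (L.arity f) → A) (hab : ∀ i, r (a i) (b i)) : r (I f a) (I f b) := by
  have key : ∀ s : Finset (Fin (L.arity f)), r (I f a) (I f (s.piecewise b a)) := by
    intro s
    induction s using Finset.induction_on with
    | empty => simpa using hrefl _
    | insert i s hi ih =>
      refine htrans _ _ _ ih ?_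
      rw [Finset.piecewise_insert]
      have h := hupd f (s.piecewise b a) i (a i) (b i) (hab i)
      have e : Function.update (s.piecewise b a) i (a i) = s.piecewise b a := by
        rw [Function.update_eq_self_iff]
        simp [hi]
      rwa [e] at h
  simpa using key Finset.univ

theorem IsCong.isHom_mk {A : Type} {I : Interp L A} {θ : A → A → Prop} (hθ : IsCong I θ) :
    IsHom I (quotInterp I θ) (Quot.mk θ) := by
  intro f a
  refine Quot.sound (hθ.2 f _ _ fun i => ?_)
  have h : Quot.mk θ (Quot.mk θ (a i)).out = Quot.mk θ (a i) := Quot.out_eq _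
  exact hθ.1.symm (hθ.1.eqvGen_iff.1 (Quot.eqvGen_exact h))

theorem IsCong.mk_eq_mk {A : Type} {I : Interp L A} {θ : A → A → Prop} (hθ : IsCong I θ)
    {x y : A} : Quot.mk θ x = Quot.mk θ y ↔ θ x y :=
  ⟨fun h => hθ.1.eqvGen_iff.1 (Quot.eqvGen_exact h), fun h => Quot.sound h⟩

theorem inVariety_quot {A : Type} {I : Interp L A} {θ : A → A → Prop} (hθ : IsCong I θ)
    {E : Set (Term L ℕ × Term L ℕ)}
    (h : ∀ e ∈ E, ∀ v : ℕ → A, θ (e.1.realize I v) (e.2.realize I v)) :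
    InVariety E (quotInterp I θ) := by
  intro e he v
  have hv : v = Quot.mk θ ∘ fun n => (v n).out := by
    funext n
    exact (Quot.out_eq _).symm
  rw [hv, ← hθ.isHom_mk.map_realize, ← hθ.isHom_mk.map_realize]
  exact Quot.sound (h e he _)

theorem Term.realize_congr {A X : Type} {I : Interp L A} {r : A → A → Prop}
    (hr : ∀ (f : L.F) (a b : Fin (L.arity f) → A), (∀ i, r (a i) (b i)) → r (I f a) (I f b))
    (t : Term L X) {v w : X → A} (h : ∀ x, r (v x) (w x)) :
    r (t.realize I v) (t.realize I w) := by
  induction t with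
  | var x => exact h x
  | app f ts ih => exact hr f _ _ ih

end Terms

section TermCondition

/-- The term condition modulo `θ`: rows of a `2 × 2` matrix of assignments, each of whose
coordinates is constant along rows or along columns. -/
def TermCondition {A : Type} (I : Interp L A) (θ : A → A → Prop) : Prop :=
  ∀ (X : Type) (t : Term L X) (v v' w w' : X → A),
    (∀ x, (v x = v' x ∧ w x = w' x) ∨ (v x = w x ∧ v' x = w' x)) →
    θ (t.realize I v) (t.realize I v') → θ (t.realize I w) (t.realize I w')

theorem IsAbelian.termCondition {A : Type} {I : Interp L A} (hI : IsAbelian I) :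
    TermCondition I (· = ·) := by
  classical
  intro X t v v' w w' hvw h
  obtain ⟨n, g, t', rfl⟩ := t.exists_fin_relabel
  simp only [Term.realize_relabel] at h ⊢
  let P : Fin n → Prop := fun i => v (g i) = v' (g i) ∧ w (g i) = w' (g i)
  let s : Fin n → (Fin n ⊕ Fin n) := fun i => if P i then .inl i else .inr i
  have hs : ∀ (a b c : Fin n → A), (∀ i, P i → a i = c i) → (∀ i, ¬ P i → b i = c i) →
      t'.realize I c = t'.realize I (Sum.elim a b ∘ s) := by
    intro a b c ha hb
    congr 1
    funext i
    by_cases hi : P i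
    · simp [s, hi, ha i hi]
    · simp [s, hi, hb i hi]
  refine hI _ _ _ _ ⟨n, n, fun z => t'.realize I (z ∘ s),
    ⟨0, t'.relabel (Sum.inl ∘ s), Fin.elim0, fun x => ?_⟩,
    v ∘ g, w ∘ g, v ∘ g, v' ∘ g, ?_, ?_, ?_, ?_⟩ h
  · rw [Term.realize_relabel]
    rfl
  · exact hs _ _ _ (fun _ _ => rfl) fun _ _ => rfl
  · exact hs _ _ _ (fun i hi => hi.1) fun _ _ => rfl
  · exact hs _ _ _ (fun _ _ => rfl) fun i hi => ((hvw (g i)).resolve_left hi).1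
  · exact hs _ _ _ (fun i hi => hi.2) fun i hi => ((hvw (g i)).resolve_left hi).2

theorem IsCong.termCondition {A : Type} {I : Interp L A} {θ : A → A → Prop} (hθ : IsCong I θ)
    (h : IsAbelian (quotInterp I θ)) : TermCondition I θ := by
  intro X t v v' w w' hvw htv
  rw [← hθ.mk_eq_mk, hθ.isHom_mk.map_realize, hθ.isHom_mk.map_realize] at htv ⊢
  refine h.termCondition X t _ _ _ _ (fun x => ?_) htv
  rcases hvw x with hx | hx
  · exact .inl ⟨congrArg _ hx.1, congrArg _ hx.2⟩
  · exact .inr ⟨congrArg _ hx.1, congrArg _ hx.2⟩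

end TermCondition

section Pointed

/-- Making some of the arguments of a term operation equal to `z` cannot destroy the value `z`. -/
def IsIsolated {B : Type} (J : Interp L B) (z : B) : Prop :=
  ∀ (X : Type) (t : Term L X) (v w : X → B), (∀ x, w x = v x ∨ w x = z) →
    t.realize J v = z → t.realize J w = z

/-- Distinct elements are separated by the preimages of `z` under unary polynomials. -/
def IsSeparating {B : Type} (J : Interp L B) (z : B) : Prop :=
  ∀ x y : B, (∀ (N : Type) (G : Term L (Option N)) (e : N → B),
    G.realize J (fun o => o.elim x e) = z ↔ G.realize J (fun o => o.elim y e) = z) → x = y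

/-- Substitution of the term `t` for the variable `none` of `G`. -/
def Term.plug {X N : Type} (G : Term L (Option N)) (t : Term L X) : Term L (X ⊕ N) :=
  G.realize (termInterp L (X ⊕ N)) (fun o => o.elim (t.relabel .inl) fun n => .var (.inr n))

theorem Term.realize_plug {B X N : Type} (J : Interp L B) (G : Term L (Option N)) (t : Term L X)
    (v : X → B) (e : N → B) :
    (G.plug t).realize J (Sum.elim v e) = G.realize J (fun o => o.elim (t.realize J v) e) := by
  rw [Term.plug, Term.realize_subst]
  congr 1
  funext o
  cases o with
  | none => exact Term.realize_relabel J _ _ t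
  | some n => rfl

variable {B : Type} {J : Interp L B} {z : B}

theorem realize_eq_zero_of_disjoint (hz : ∀ (X : Type) (t : Term L X), t.realize J (fun _ => z) = z)
    (habs : TermCondition J (· = ·)) (hiso : IsIsolated J z) (hsep : IsSeparating J z)
    {X : Type} (t : Term L X) (v w : X → B) (hvw : ∀ x, v x = z ∨ w x = z)
    (h : t.realize J v = t.realize J w) : t.realize J w = z := by
  classical
  let u : X → B := fun x => if v x = z then w x else v x
  have hu : ∀ x, (v x = z ∧ u x = w x) ∨ (w x = z ∧ u x = v x) := by
    intro x
    by_cases hx : v x = z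
    · exact .inl ⟨hx, by simp [u, hx]⟩
    · exact .inr ⟨(hvw x).resolve_left hx, by simp [u, hx]⟩
  have hvu : t.realize J v = t.realize J u := by
    apply hsep
    intro N G e
    simp only [← Term.realize_plug]
    constructor
    · intro hG
      have hG' : (G.plug t).realize J (Sum.elim w fun _ => z) = z := by
        refine hiso _ _ (Sum.elim w e) _ ?_ ?_
        · rintro (x | n) <;> simp
        · rw [Term.realize_plug, ← h, ← Term.realize_plug, hG]
      refine (habs _ (G.plug t) (fun _ => z) (Sum.elim w fun _ => z) (Sum.elim v e)
        (Sum.elim u e) ?_ ?_).symm.trans hG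
      · rintro (x | n)
        · rcases hu x with hx | hx
          · exact .inr ⟨hx.1.symm, hx.2.symm⟩
          · exact .inl ⟨hx.1.symm, hx.2.symm⟩
        · exact .inl ⟨rfl, rfl⟩
      · rw [hG', hz]
    · refine hiso _ _ _ _ ?_
      rintro (x | n)
      · rcases hu x with hx | hx
        · exact .inr hx.1
        · exact .inl hx.2.symm
      · exact .inl rfl
  refine (habs _ t v u (fun _ => z) w ?_ hvu).symm.trans (hz _ t)
  intro x
  rcases hu x with hx | hx
  · exact .inr ⟨hx.1, hx.2⟩
  · exact .inl ⟨hx.2.symm, hx.1.symm⟩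

theorem realize_eq_of_matrix (hz : ∀ (X : Type) (t : Term L X), t.realize J (fun _ => z) = z)
    (habs : TermCondition J (· = ·)) (hiso : IsIsolated J z) (hsep : IsSeparating J z)
    {X : Type} (t : Term L X) (P Q R S : X → B)
    (hmat : ∀ x, (P x = Q x ∧ R x = S x) ∨ (P x = R x ∧ Q x = S x))
    (h : t.realize J Q = t.realize J R) : t.realize J R = t.realize J S := by
  classical
  let α : X → Prop := fun x => P x = Q x ∧ R x = S x
  have hα : ∀ x, α x → R x = S x := fun x hx => hx.2
  have hα' : ∀ x, ¬ α x → Q x = S x := fun x hx => ((hmat x).resolve_left hx).2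
  let on : (X → B) → X → B := fun V x => if α x then V x else z
  let off : (X → B) → X → B := fun V x => if α x then z else V x
  apply hsep
  intro N G e
  simp only [← Term.realize_plug]
  set H := G.plug t with hH
  have hQR : H.realize J (Sum.elim Q e) = H.realize J (Sum.elim R e) := by
    simp only [hH, Term.realize_plug, h]
  have hzero : ∀ V : X → B, H.realize J (Sum.elim V e) = z →
      H.realize J (Sum.elim (off V) fun _ => z) = z := by
    intro V
    refine hiso _ _ _ _ ?_
    rintro (x | n)
    · by_cases hx : α x <;> simp [off, hx]
    · exact .inr rfl
  constructor
  · intro hR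
    refine (habs _ H (Sum.elim (off R) fun _ => z) (Sum.elim (off S) fun _ => z)
      (Sum.elim R e) (Sum.elim S e) ?_ ?_).symm.trans hR
    · rintro (x | n)
      · by_cases hx : α x
        · simp [off, hx, hα x hx]
        · simp [off, hx]
      · exact .inl ⟨rfl, rfl⟩
    · have hQ := hzero Q (hQR.trans hR)
      have : off Q = off S := by
        funext x
        by_cases hx : α x
        · simp [off, hx]
        · simp [off, hx, hα' x hx]
      rw [this] at hQ
      exact (hzero R hR).trans hQ.symm
  · intro hS
    have hon : H.realize J (Sum.elim (on S) e) = z := by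
      refine hiso _ _ _ _ ?_ hS
      rintro (x | n)
      · by_cases hx : α x <;> simp [on, hx]
      · exact .inl rfl
    have hoff : H.realize J (Sum.elim (off S) e) = z := by
      refine hiso _ _ _ _ ?_ hS
      rintro (x | n)
      · by_cases hx : α x <;> simp [off, hx]
      · exact .inl rfl
    have hR : H.realize J (Sum.elim (off R) fun _ => z) = H.realize J (Sum.elim R e) := by
      refine habs _ H (fun _ => z) (Sum.elim (on S) e) _ _ ?_ ((hz _ H).trans hon.symm)
      rintro (x | n)
      · by_cases hx : α x
        · simp [on, off, hx, hα x hx]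
        · simp [on, off, hx]
      · exact .inr ⟨rfl, rfl⟩
    have hQ : H.realize J (Sum.elim (on Q) fun _ => z) = H.realize J (Sum.elim Q e) := by
      refine habs _ H (fun _ => z) (Sum.elim (off S) e) _ _ ?_ ((hz _ H).trans hoff.symm)
      rintro (x | n)
      · by_cases hx : α x
        · simp [on, off, hx]
        · simp [on, off, hx, hα' x hx]
      · exact .inr ⟨rfl, rfl⟩
    rw [← hR]
    refine realize_eq_zero_of_disjoint hz habs hiso hsep H (Sum.elim (on Q) fun _ => z) _ ?_ ?_
    · rintro (x | n)
      · by_cases hx : α x <;> simp [on, off, hx]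
      · exact .inl rfl
    · rw [hQ, hR, hQR]

theorem isStronglyRectangular_of_isolated
    (hz : ∀ (X : Type) (t : Term L X), t.realize J (fun _ => z) = z)
    (habs : TermCondition J (· = ·)) (hiso : IsIsolated J z) (hsep : IsSeparating J z) :
    IsStronglyRectangular J := by
  rintro p q r s ⟨k, l, t, ⟨m, T, c, hT⟩, a, b, u, v, rfl, rfl, rfl, rfl⟩ h
  rw [hT, hT] at h ⊢
  refine realize_eq_of_matrix hz habs hiso hsep T (Sum.elim (Sum.elim a u) c) _ _ _ ?_ h
  rintro ((i | j) | n)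
  · exact .inl ⟨rfl, rfl⟩
  · exact .inr ⟨rfl, rfl⟩
  · exact .inl ⟨rfl, rfl⟩

end Pointed

section Ordered

variable {A : Type} {I : Interp L A} {r : A → A → Prop}

/-- The algebra of all pairs related by a compatible relation. -/
def relInterp (I : Interp L A) (r : A → A → Prop)
    (hr : ∀ (f : L.F) (a b : Fin (L.arity f) → A), (∀ i, r (a i) (b i)) → r (I f a) (I f b)) :
    Interp L {p : A × A // r p.1 p.2} :=
  fun f a => ⟨(I f fun i => (a i).1.1, I f fun i => (a i).1.2), hr f _ _ fun i => (a i).2⟩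

/-- The largest congruence for which `Z` is a union of classes. -/
def syntacticCong {C : Type} (J : Interp L C) (Z : C → Prop) : C → C → Prop :=
  fun c d => ∀ G : Term L (Option C),
    Z (G.realize J fun o => o.elim c id) ↔ Z (G.realize J fun o => o.elim d id)

theorem isCong_syntacticCong {C : Type} (J : Interp L C) (Z : C → Prop) :
    IsCong J (syntacticCong J Z) := by
  have hE : Equivalence (syntacticCong J Z) :=
    ⟨fun _ _ => Iff.rfl, fun h G => (h G).symm, fun h h' G => (h G).trans (h' G)⟩
  refine ⟨hE, compatible_of_update J hE.refl (fun _ _ _ => hE.trans) fun f a i x y hxy G => ?_⟩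
  let σ : Option C → Term L (Option C) := fun o =>
    o.elim (.app f fun j => if j = i then .var none else .var (some (a j))) fun c => .var (some c)
  have h : ∀ z, G.realize J (fun o => o.elim (J f (Function.update a i z)) id) =
      (G.realize (termInterp L _) σ).realize J fun o => o.elim z id := by
    intro z
    rw [Term.realize_subst]
    congr 1
    funext o
    cases o with
    | none =>
      simp only [σ, Option.elim, Term.realize]
      congr 1
      funext j
      by_cases hj : j = i
      · subst hj
        simp [Term.realize]
      · simp [hj, Term.realize]
    | some c => rfl
  rw [h, h]
  exact hxy _

/-- If a preorder with a strict pair is compatible with an algebra whose quotient by the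
symmetric part of the preorder lies in an abelian variety, then this variety contains a nontrivial
strongly abelian algebra. -/
theorem exists_stronglyAbelian_of_preorder (E : Set (Term L ℕ × Term L ℕ))
    (habelian : ∀ (A : Type) (I : Interp L A), InVariety E I → IsAbelian I)
    (hrefl : ∀ x, r x x) (htrans : ∀ x y z, r x y → r y z → r x z)
    (hr : ∀ (f : L.F) (a b : Fin (L.arity f) → A), (∀ i, r (a i) (b i)) → r (I f a) (I f b))
    (hV : ∀ e ∈ E, ∀ v : ℕ → A, r (e.1.realize I v) (e.2.realize I v) ∧
      r (e.2.realize I v) (e.1.realize I v))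
    (hstrict : ∃ x y, r x y ∧ ¬ r y x) :
    ∃ (B : Type) (J : Interp L B),
      InVariety E J ∧ IsStronglyAbelian J ∧ ∃ x y : B, x ≠ y := by
  classical
  obtain ⟨x₀, y₀, hxy, hyx⟩ := hstrict
  let θ : A → A → Prop := fun x y => r x y ∧ r y x
  have hθE : Equivalence θ := ⟨fun x => ⟨hrefl x, hrefl x⟩, fun h => ⟨h.2, h.1⟩,
    fun h h' => ⟨htrans _ _ _ h.1 h'.1, htrans _ _ _ h'.2 h.2⟩⟩
  have hθ : IsCong I θ := ⟨hθE, fun f a b h =>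
    ⟨hr f _ _ fun i => (h i).1, hr f _ _ fun i => (h i).2⟩⟩
  have hTC : TermCondition I θ := hθ.termCondition (habelian _ _ (inVariety_quot hθ hV))
  let C := {p : A × A // r p.1 p.2}
  let K : Interp L C := relInterp I r hr
  let Z : C → Prop := fun c => θ c.1.1 c.1.2
  let χ := syntacticCong K Z
  have hχ : IsCong K χ := isCong_syntacticCong K Z
  have hfst : IsHom K I fun c : C => c.1.1 := fun _ _ => rfl
  have hsnd : IsHom K I fun c : C => c.1.2 := fun _ _ => rfl
  have hχ_of_θ : ∀ c d : C, θ c.1.1 d.1.1 → θ c.1.2 d.1.2 → χ c d := by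
    intro c d h₁ h₂ G
    have key : ∀ {h : C → A} (_ : IsHom K I h) (_ : θ (h c) (h d)),
        θ (h (G.realize K fun o => o.elim c id)) (h (G.realize K fun o => o.elim d id)) := by
      intro h hh hcd
      rw [hh.map_realize, hh.map_realize]
      refine Term.realize_congr hθ.2 G fun o => ?_
      cases o with
      | none => exact hcd
      | some c => exact hθE.refl _
    have k₁ := key hfst h₁
    have k₂ := key hsnd h₂
    exact ⟨fun h => hθE.trans (hθE.symm k₁) (hθE.trans h k₂),
      fun h => hθE.trans k₁ (hθE.trans h (hθE.symm k₂))⟩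
  have hV' : InVariety E (quotInterp K χ) := by
    refine inVariety_quot hχ fun e he v => hχ_of_θ _ _ ?_ ?_
    · rw [hfst.map_realize, hfst.map_realize]
      exact hV e he _
    · rw [hsnd.map_realize, hsnd.map_realize]
      exact hV e he _
  have hZ_of_χ : ∀ c d : C, χ c d → Z c → Z d := fun c d h => (h (.var none)).1
  have hχ_of_Z : ∀ c d : C, Z c → Z d → χ c d := by
    have key : ∀ c d : C, Z c → Z d → ∀ G : Term L (Option C),
        Z (G.realize K fun o => o.elim c id) → Z (G.realize K fun o => o.elim d id) := by
      intro c d hc hd G hG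
      change θ (_ : A) _ at hG
      change θ (_ : A) _
      rw [hfst.map_realize, hsnd.map_realize] at hG ⊢
      let a : A → Option C → A := fun x o => o.elim x fun e => e.1.1
      let b : A → Option C → A := fun x o => o.elim x fun e => e.1.2
      have h₁ : θ (G.realize I (a c.1.1)) (G.realize I (b c.1.1)) := by
        refine hθE.trans (y := G.realize I (b c.1.2)) ?_ ?_
        · convert hG using 2 <;> (funext o; cases o <;> rfl)
        · refine Term.realize_congr hθ.2 G fun o => ?_
          cases o with
          | none => exact hθE.symm hc
          | some e => exact hθE.refl _
      have h₂ : θ (G.realize I (a d.1.1)) (G.realize I (b d.1.1)) := by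
        refine hTC _ G _ _ _ _ (fun o => ?_) h₁
        cases o with
        | none => exact .inl ⟨rfl, rfl⟩
        | some e => exact .inr ⟨rfl, rfl⟩
      have h₃ : θ (G.realize I (b d.1.1)) (G.realize I (b d.1.2)) := by
        refine Term.realize_congr hθ.2 G fun o => ?_
        cases o with
        | none => exact hd
        | some e => exact hθE.refl _
      convert hθE.trans h₂ h₃ using 2 <;> (funext o; cases o <;> rfl)
    exact fun c d hc hd G => ⟨key c d hc hd G, key d c hd hc G⟩
  have hZ_isolated : ∀ (X : Type) (t : Term L X) (v w : X → C), (∀ x, w x = v x ∨ Z (w x)) →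
      Z (t.realize K v) → Z (t.realize K w) := by
    intro X t v w hvw hv
    change θ (_ : A) _ at hv
    change θ (_ : A) _
    rw [hfst.map_realize, hsnd.map_realize] at hv ⊢
    let m : (X → A) → X → A := fun u x => if w x = v x then (v x).1.2 else u x
    have h₁ : θ (t.realize I fun x => (v x).1.1) (t.realize I (m fun x => (v x).1.1)) := by
      constructor
      · refine Term.realize_congr hr t fun x => ?_
        by_cases hx : w x = v x
        · simpa [m, hx] using (v x).2
        · simpa [m, hx] using hrefl _
      · refine htrans _ _ _ (Term.realize_congr hr t (w := fun x => (v x).1.2) fun x => ?_) hv.2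
        by_cases hx : w x = v x
        · simpa [m, hx] using hrefl _
        · simpa [m, hx] using (v x).2
    have h₂ : θ (t.realize I fun x => (w x).1.1) (t.realize I (m fun x => (w x).1.1)) := by
      refine hTC _ t _ _ _ _ (fun x => ?_) h₁
      by_cases hx : w x = v x
      · exact .inr (by simp [m, hx])
      · exact .inl (by simp [m, hx])
    refine hθE.trans h₂ (Term.realize_congr hθ.2 t fun x => ?_)
    by_cases hx : w x = v x
    · simpa [m, hx] using hθE.refl _
    · simpa [m, hx] using (hvw x).resolve_left hx
  let c₀ : C := ⟨(x₀, x₀), hrefl x₀⟩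
  have hc₀ : Z c₀ := hθE.refl x₀
  let z : Quot χ := Quot.mk χ c₀
  have hmk : ∀ c : C, Quot.mk χ c = z ↔ Z c := fun c =>
    ⟨fun h => hZ_of_χ _ _ (hχ.1.symm (hχ.mk_eq_mk.1 h)) hc₀, fun h => Quot.sound (hχ_of_Z _ _ h hc₀)⟩
  have hlift : ∀ {X : Type} (v : X → Quot χ), v = Quot.mk χ ∘ fun x => (v x).out :=
    fun v => funext fun x => (Quot.out_eq _).symm
  have hab : IsAbelian (quotInterp K χ) := habelian _ _ hV'
  have hz : ∀ (X : Type) (t : Term L X), t.realize (quotInterp K χ) (fun _ => z) = z := by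
    intro X t
    change t.realize _ (Quot.mk χ ∘ fun _ => c₀) = z
    rw [← hχ.isHom_mk.map_realize, hmk]
    change θ (_ : A) _
    rw [hfst.map_realize, hsnd.map_realize]
    exact hθE.refl _
  have hiso : IsIsolated (quotInterp K χ) z := by
    intro X t v w hvw hv
    have hw : w = Quot.mk χ ∘ fun x => if w x = v x then (v x).out else c₀ := by
      funext x
      by_cases hx : w x = v x
      · simp [hx]
      · simpa [hx] using (hvw x).resolve_left hx
    rw [hlift v, ← hχ.isHom_mk.map_realize, hmk] at hv
    rw [hw, ← hχ.isHom_mk.map_realize, hmk]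
    refine hZ_isolated X t _ _ (fun x => ?_) hv
    by_cases hx : w x = v x
    · simp [hx]
    · exact .inr (by simpa [hx] using hc₀)
  have hsep : IsSeparating (quotInterp K χ) z := by
    intro x y
    induction x using Quot.ind with | mk c
    induction y using Quot.ind with | mk d
    refine fun h => Quot.sound fun G => ?_
    have := h C G (Quot.mk χ)
    have e : ∀ c : C, (fun o : Option C => o.elim (Quot.mk χ c) (Quot.mk χ)) =
        Quot.mk χ ∘ fun o => o.elim c id := by
      intro c
      funext o
      cases o <;> rfl
    rwa [e, e, ← hχ.isHom_mk.map_realize, ← hχ.isHom_mk.map_realize, hmk, hmk] at this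
  refine ⟨Quot χ, quotInterp K χ, hV', ⟨hab, isStronglyRectangular_of_isolated hz
    hab.termCondition hiso hsep⟩, z, Quot.mk χ ⟨(x₀, y₀), hxy⟩, fun h => hyx ?_⟩
  exact ((hmk _).1 h.symm).2

end Ordered

section Maltsev

/-- `s ≈ t` holds throughout the variety `Mod(E)`. -/
def EqInVariety (E : Set (Term L ℕ × Term L ℕ)) {X : Type} (s t : Term L X) : Prop :=
  ∀ (A : Type) (I : Interp L A), InVariety E I → ∀ v : X → A, s.realize I v = t.realize I v

/-- The compatible reflexive relation generated by the pair of the variables `(0, 1)` in the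
free algebra of `Mod(E)`, considered as a relation between terms. -/
def GenRel (E : Set (Term L ℕ × Term L ℕ)) (s t : Term L (Fin 2)) : Prop :=
  ∃ T : Term L (Fin 3),
    EqInVariety E s (T.realize (termInterp L _) ![.var 0, .var 0, .var 1]) ∧
    EqInVariety E t (T.realize (termInterp L _) ![.var 1, .var 0, .var 1])

variable {E : Set (Term L ℕ × Term L ℕ)}

theorem realize_vec₃ {A X : Type} (I : Interp L A) (v : X → A) (T : Term L (Fin 3))
    (a b c : Term L X) :
    (T.realize (termInterp L _) ![a, b, c]).realize I v =
      T.realize I ![a.realize I v, b.realize I v, c.realize I v] := by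
  rw [Term.realize_subst]
  congr 1
  funext i
  fin_cases i <;> rfl

theorem genRel_iff {s t : Term L (Fin 2)} : GenRel E s t ↔ ∃ T : Term L (Fin 3),
    ∀ (A : Type) (I : Interp L A), InVariety E I → ∀ x y : A,
      s.realize I ![x, y] = T.realize I ![x, x, y] ∧
      t.realize I ![x, y] = T.realize I ![y, x, y] := by
  refine exists_congr fun T => ?_
  simp only [EqInVariety, realize_vec₃, Term.realize]
  constructor
  · intro h A I hI x y
    exact ⟨h.1 A I hI ![x, y], h.2 A I hI ![x, y]⟩
  · intro h
    have e : ∀ {A : Type} (v : Fin 2 → A), v = ![v 0, v 1] := by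
      intro A v
      funext i
      fin_cases i <;> rfl
    exact ⟨fun A I hI v => (congrArg (fun u => s.realize I u) (e v)).trans (h A I hI _ _).1,
      fun A I hI v => (congrArg (fun u => t.realize I u) (e v)).trans (h A I hI _ _).2⟩

theorem genRel_of_eqInVariety {s t : Term L (Fin 2)} (h : EqInVariety E s t) : GenRel E s t := by
  refine genRel_iff.2 ⟨s.relabel ![1, 2], fun A I hI x y => ?_⟩
  have e : ∀ u : A, (![u, x, y] : Fin 3 → A) ∘ (![1, 2] : Fin 2 → Fin 3) = ![x, y] := by
    intro u
    funext i
    fin_cases i <;> rfl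
  rw [Term.realize_relabel, Term.realize_relabel, e, e]
  exact ⟨rfl, (h A I hI _).symm⟩

theorem genRel_compatible (f : L.F) (a b : Fin (L.arity f) → Term L (Fin 2))
    (hab : ∀ i, GenRel E (a i) (b i)) :
    GenRel E (termInterp L _ f a) (termInterp L _ f b) := by
  simp only [genRel_iff] at hab ⊢
  choose T hT using hab
  refine ⟨.app f T, fun A I hI x y => ⟨?_, ?_⟩⟩
  · exact congrArg (I f) (funext fun i => (hT i A I hI x y).1)
  · exact congrArg (I f) (funext fun i => (hT i A I hI x y).2)

theorem reflTransGen_genRel_compatible (f : L.F) (a b : Fin (L.arity f) → Term L (Fin 2))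
    (hab : ∀ i, Relation.ReflTransGen (GenRel E) (a i) (b i)) :
    Relation.ReflTransGen (GenRel E) (termInterp L _ f a) (termInterp L _ f b) := by
  refine compatible_of_update _ (fun _ => .refl) (fun _ _ _ => .trans) ?_ f a b hab
  intro f a i x y hxy
  refine hxy.lift (fun z => termInterp L _ f (Function.update a i z)) fun s t hst => ?_
  refine genRel_compatible f _ _ fun j => ?_
  by_cases hj : j = i
  · subst hj
    simpa using hst
  · simpa [hj] using genRel_of_eqInVariety (E := E) fun _ _ _ _ => rfl

/-- In an abelian variety, two consecutive steps starting at the larger generator can be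
replaced by a single one. -/
theorem genRel_trans (habelian : ∀ (A : Type) (I : Interp L A), InVariety E I → IsAbelian I)
    {s t : Term L (Fin 2)} (h₁ : GenRel E (.var 1) s) (h₂ : GenRel E s t) :
    GenRel E (.var 1) t := by
  rw [genRel_iff] at h₁ h₂ ⊢
  obtain ⟨S, hS⟩ := h₁
  obtain ⟨T, hT⟩ := h₂
  refine ⟨S.realize (termInterp L _) ![.var 0, .var 2, T], fun A I hI x y => ?_⟩
  simp only [realize_vec₃]
  have hS₁ : ∀ a b : A, S.realize I ![a, a, b] = b := fun a b => (hS A I hI a b).1.symm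
  have hS₂ : S.realize I ![y, x, y] = T.realize I ![x, x, y] :=
    (hS A I hI x y).2.symm.trans (hT A I hI x y).1
  constructor
  · change y = S.realize I ![x, y, T.realize I ![x, x, y]]
    rw [← hS₂]
    let N : Term L (Fin 4) := S.realize (termInterp L _)
      ![.var 0, .var 1, S.realize (termInterp L _) ![.var 1, .var 2, .var 3]]
    have h := (habelian A I hI).termCondition _ N ![y, y, x, y] ![y, x, x, y] ![x, y, x, y]
      ![x, x, x, y] (by intro i; fin_cases i <;> simp)
    simp only [N, realize_vec₃, Term.realize] at h
    change S.realize I ![y, y, S.realize I ![y, x, y]] =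
      S.realize I ![y, x, S.realize I ![x, x, y]] →
      S.realize I ![x, y, S.realize I ![y, x, y]] =
      S.realize I ![x, x, S.realize I ![x, x, y]] at h
    simp only [hS₁, forall_const] at h
    exact h.symm
  · change t.realize I ![x, y] = S.realize I ![y, y, T.realize I ![y, x, y]]
    rw [hS₁]
    exact (hT A I hI x y).2

end Maltsev

/-- If every member of the variety `Mod(E)` is abelian and some member is
not affine, then `Mod(E)` contains a strongly abelian algebra with more than one
element. -/
theorem statement1 {L : Lang} (E : Set (Term L ℕ × Term L ℕ))
    (habelian : ∀ (A : Type) (I : Interp L A), InVariety E I → IsAbelian I)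
    (hnotaffine : ∃ (A : Type) (I : Interp L A), InVariety E I ∧ ¬ HasMaltsevPoly I) :
    ∃ (B : Type) (J : Interp L B),
      InVariety E J ∧ IsStronglyAbelian J ∧ ∃ x y : B, x ≠ y := by
  by_cases h : Relation.ReflTransGen (GenRel E) (.var 1) (.var 0)
  · have hgen : ∀ s, Relation.ReflTransGen (GenRel E) (.var 1) s → GenRel E (.var 1) s := by
      intro s hs
      induction hs with
      | refl => exact genRel_of_eqInVariety fun _ _ _ _ => rfl
      | tail _ h₂ ih => exact genRel_trans habelian ih h₂
    obtain ⟨S, hS⟩ := genRel_iff.1 (hgen _ h)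
    obtain ⟨A, I, hI, hM⟩ := hnotaffine
    refine absurd ⟨fun v => S.realize I ![v 1, v 0, v 2],
      ⟨0, S.relabel (Sum.inl ∘ ![1, 0, 2]), Fin.elim0, fun v => ?_⟩, fun x y => ⟨?_, ?_⟩⟩ hM
    · rw [Term.realize_relabel]
      refine congrArg (fun u => S.realize I u) (funext fun i => ?_)
      fin_cases i <;> rfl
    · exact (hS A I hI x y).2.symm
    · exact (hS A I hI y x).1.symm
  · have hV : ∀ e ∈ E, ∀ v : ℕ → Term L (Fin 2), EqInVariety E
        (e.1.realize (termInterp L _) v) (e.2.realize (termInterp L _) v) := by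
      intro e he v A I hI w
      rw [Term.realize_subst, Term.realize_subst]
      exact hI e he _
    refine exists_stronglyAbelian_of_preorder E habelian (fun _ => .refl) (fun _ _ _ => .trans)
      reflTransGen_genRel_compatible (fun e he v => ⟨.single (genRel_of_eqInVariety (hV e he v)),
        .single (genRel_of_eqInVariety fun A I hI w => (hV e he v A I hI w).symm)⟩)
      ⟨.var 0, .var 1, .single ⟨.var 0, fun _ _ _ _ => rfl, fun _ _ _ _ => rfl⟩, h⟩

end UA
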